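/- arXiv:1303.4358 — 2 statements merged into one kernel-verified Lean document; each statement's English description precedes it below -/
import Mathlib

section
/- For every λ>0, every x∈ℝ³∖{0} and all i,j∈{1,2,3}, the fundamental Stokes tensor satisfies the Stokes resolvent equation away from the origin: Δ(Γ^λ_{ij})(x) + λ·Γ^λ_{ij}(x) = ∂_{x_j} F_i(x), where Δ is the Laplacian on ℝ³. -/
open MeasureTheory

/-- Classical partial derivative `∂_i f` of a function `f : ℝ³ → ℂ`. -/
noncomputable def pd (i : Fin 3) (f : EuclideanSpace ℝ (Fin 3) → ℂ) :
    EuclideanSpace ℝ (Fin 3) → ℂ :=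
  fun x => fderiv ℝ f x (EuclideanSpace.single i 1)

/-- The fundamental tensor `Γ^λ_{ij}` of the Stokes resolvent system:
`Γ^λ_{ij}(x) = −δ_{ij} e^{i√λ|x|}/(4π|x|) − (1/(4πλ)) ∂_i∂_j[(e^{i√λ|x|}−1)/|x|]`. -/
noncomputable def GammaLam (lam : ℝ) (i j : Fin 3)
    (x : EuclideanSpace ℝ (Fin 3)) : ℂ :=
  -(if i = j then (1 : ℂ) else 0) *
      Complex.exp (Complex.I * (Real.sqrt lam : ℂ) * (‖x‖ : ℂ)) /
        (4 * (Real.pi : ℂ) * (‖x‖ : ℂ))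
    - (1 / (4 * (Real.pi : ℂ) * (lam : ℂ))) *
        pd i (pd j (fun y =>
          (Complex.exp (Complex.I * (Real.sqrt lam : ℂ) * (‖y‖ : ℂ)) - 1) / (‖y‖ : ℂ))) x

/-- The pressure vector `F_i(x) = −x_i/(4π|x|³)` (as a complex-valued function). -/
noncomputable def Fvec (i : Fin 3) (x : EuclideanSpace ℝ (Fin 3)) : ℂ :=
  -(x i : ℂ) / (4 * (Real.pi : ℂ) * (‖x‖ : ℂ) ^ 3)

open scoped ContDiff

/-- Euclidean three-space. -/
local notation "E3" => EuclideanSpace ℝ (Fin 3)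

/-- Smoothness on the punctured space `ℝ³ ∖ {0}`. -/
def SmoothOffZero (f : E3 → ℂ) : Prop :=
  ∀ y, y ≠ 0 → ContDiffAt ℝ ∞ f y

namespace SmoothOffZero

variable {f g : E3 → ℂ}

theorem add (hf : SmoothOffZero f) (hg : SmoothOffZero g) :
    SmoothOffZero (fun y => f y + g y) :=
  fun y hy => (hf y hy).add (hg y hy)

theorem sub (hf : SmoothOffZero f) (hg : SmoothOffZero g) :
    SmoothOffZero (fun y => f y - g y) :=
  fun y hy => (hf y hy).sub (hg y hy)

theorem const_mul (c : ℂ) (hf : SmoothOffZero f) : SmoothOffZero (fun y => c * f y) :=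
  fun y hy => contDiffAt_const.mul (hf y hy)

theorem differentiableAt (hf : SmoothOffZero f) {x : E3} (hx : x ≠ 0) :
    DifferentiableAt ℝ f x :=
  (hf x hx).differentiableAt (by simp)

theorem pd (i : Fin 3) (hf : SmoothOffZero f) : SmoothOffZero (pd i f) :=
  fun y hy => ((hf y hy).fderiv_right (m := ∞) (by simp)).clm_apply contDiffAt_const

end SmoothOffZero

theorem pd_congr (i : Fin 3) {f g : E3 → ℂ} (h : ∀ y, y ≠ 0 → f y = g y)
    {x : E3} (hx : x ≠ 0) : pd i f x = pd i g x := by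
  have : f =ᶠ[nhds x] g := by
    filter_upwards [isOpen_ne.mem_nhds hx] with y hy using h y hy
  simp only [pd, this.fderiv_eq]

theorem pd_sub (i : Fin 3) {f g : E3 → ℂ} (hf : SmoothOffZero f) (hg : SmoothOffZero g)
    {x : E3} (hx : x ≠ 0) : pd i (fun y => f y - g y) x = pd i f x - pd i g x := by
  simp only [pd]
  rw [fderiv_fun_sub (hf.differentiableAt hx) (hg.differentiableAt hx)]
  rfl

theorem pd_add (i : Fin 3) {f g : E3 → ℂ} (hf : SmoothOffZero f) (hg : SmoothOffZero g)
    {x : E3} (hx : x ≠ 0) : pd i (fun y => f y + g y) x = pd i f x + pd i g x := by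
  simp only [pd]
  rw [fderiv_fun_add (hf.differentiableAt hx) (hg.differentiableAt hx)]
  rfl

theorem pd_const_mul (i : Fin 3) (c : ℂ) {f : E3 → ℂ} (hf : SmoothOffZero f)
    {x : E3} (hx : x ≠ 0) : pd i (fun y => c * f y) x = c * pd i f x := by
  simp only [pd]
  rw [fderiv_const_mul (hf.differentiableAt hx)]
  rfl

theorem pd_comm (i j : Fin 3) {f : E3 → ℂ} (hf : SmoothOffZero f)
    {x : E3} (hx : x ≠ 0) : pd i (pd j f) x = pd j (pd i f) x := by
  have hd : DifferentiableAt ℝ (fderiv ℝ f) x :=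
    ((hf x hx).fderiv_right (m := ∞) (by simp)).differentiableAt (by simp)
  have key (a b : Fin 3) : pd a (pd b f) x =
      fderiv ℝ (fderiv ℝ f) x (EuclideanSpace.single a 1) (EuclideanSpace.single b 1) := by
    have := hd.hasFDerivAt.clm_apply
      (hasFDerivAt_const (EuclideanSpace.single b (1 : ℝ)) x)
    change fderiv ℝ (fun y => fderiv ℝ f y (EuclideanSpace.single b 1)) x _ = _
    rw [this.fderiv]
    simp
  rw [key, key]
  exact ((hf x hx).isSymmSndFDerivAt (by simpa using ENat.LEInfty.out)).eq _ _

/-- The Laplacian `∑ₖ ∂ₖ∂ₖ f` on `ℝ³`. -/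
noncomputable def lap (f : E3 → ℂ) (x : E3) : ℂ :=
  ∑ k : Fin 3, pd k (pd k f) x

theorem lap_congr {f g : E3 → ℂ} (h : ∀ y, y ≠ 0 → f y = g y)
    {x : E3} (hx : x ≠ 0) : lap f x = lap g x :=
  Finset.sum_congr rfl fun k _ => pd_congr k (fun _ hy => pd_congr k h hy) hx

theorem lap_sub {f g : E3 → ℂ} (hf : SmoothOffZero f) (hg : SmoothOffZero g)
    {x : E3} (hx : x ≠ 0) : lap (fun y => f y - g y) x = lap f x - lap g x := by
  simp only [lap, ← Finset.sum_sub_distrib]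
  refine Finset.sum_congr rfl fun k _ => ?_
  rw [pd_congr k (fun y hy => pd_sub k hf hg hy) hx, pd_sub k (hf.pd k) (hg.pd k) hx]

theorem lap_const_mul (c : ℂ) {f : E3 → ℂ} (hf : SmoothOffZero f)
    {x : E3} (hx : x ≠ 0) : lap (fun y => c * f y) x = c * lap f x := by
  simp only [lap, Finset.mul_sum]
  refine Finset.sum_congr rfl fun k _ => ?_
  rw [pd_congr k (fun y hy => pd_const_mul k c hf hy) hx, pd_const_mul k c (hf.pd k) hx]

theorem lap_pd (i : Fin 3) {f : E3 → ℂ} (hf : SmoothOffZero f)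
    {x : E3} (hx : x ≠ 0) : lap (pd i f) x = pd i (lap f) x := by
  have hk (k : Fin 3) : SmoothOffZero (pd k (pd k f)) := (hf.pd k).pd k
  have hswap (k : Fin 3) : pd k (pd k (pd i f)) x = pd i (pd k (pd k f)) x := by
    rw [pd_congr k (fun y hy => pd_comm k i hf hy) hx, pd_comm k i (hf.pd k) hx]
  have hlap : lap f =
      fun y => pd 0 (pd 0 f) y + pd 1 (pd 1 f) y + pd 2 (pd 2 f) y := by
    ext y
    simp [lap, Fin.sum_univ_three]
  rw [hlap, pd_add i ((hk 0).add (hk 1)) (hk 2) hx, pd_add i (hk 0) (hk 1) hx]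
  simp [lap, Fin.sum_univ_three, hswap]

theorem hasFDerivAt_comp_norm {h : ℝ → ℂ} {h' : ℂ} {x : E3} (hx : x ≠ 0)
    (hh : HasDerivAt h h' ‖x‖) :
    HasFDerivAt (fun y : E3 => h ‖y‖)
      ((‖x‖⁻¹ • innerSL ℝ x).smulRight h') x := by
  have hn : HasFDerivAt (fun y : E3 => ‖y‖) (‖x‖⁻¹ • innerSL ℝ x) x := by
    have h1 := (hasStrictFDerivAt_norm_sq x).hasFDerivAt.sqrt
      (pow_ne_zero 2 (norm_ne_zero_iff.2 hx))
    simp only [Real.sqrt_sq (norm_nonneg _)] at h1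
    refine h1.congr_fderiv ?_
    ext v
    simp
    ring
  have h2 := hh.hasFDerivAt.comp x hn
  refine h2.congr_fderiv ?_
  ext v
  simp [mul_assoc]

theorem pd_comp_norm (i : Fin 3) {h : ℝ → ℂ} {h' : ℂ} {x : E3} (hx : x ≠ 0)
    (hh : HasDerivAt h h' ‖x‖) :
    pd i (fun y => h ‖y‖) x = (x i : ℂ) * (h' / ‖x‖) := by
  simp only [pd, (hasFDerivAt_comp_norm hx hh).fderiv]
  simp [EuclideanSpace.inner_single_right]
  ring

theorem pd_coord_mul_comp_norm (i : Fin 3) {q : ℝ → ℂ} {q' : ℂ} {x : E3} (hx : x ≠ 0)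
    (hq : HasDerivAt q q' ‖x‖) :
    pd i (fun y => (y i : ℂ) * q ‖y‖) x = q ‖x‖ + (x i : ℂ) ^ 2 * (q' / ‖x‖) := by
  have hc : HasFDerivAt (fun y : E3 => ((y i : ℝ) : ℂ))
      (Complex.ofRealCLM.comp (EuclideanSpace.proj i : E3 →L[ℝ] ℝ)) x :=
    (Complex.ofRealCLM.comp (EuclideanSpace.proj i : E3 →L[ℝ] ℝ)).hasFDerivAt
  have hm : fderiv ℝ (fun y : E3 => (y i : ℂ) * q ‖y‖) x = _ :=
    (hc.mul (hasFDerivAt_comp_norm hx hq)).fderiv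
  simp only [pd, hm]
  simp [EuclideanSpace.inner_single_right]
  ring

/-- The outgoing spherical wave `e^{iκ|x|}/|x|`. -/
noncomputable def sphericalWave (κ : ℂ) (x : E3) : ℂ :=
  Complex.exp (Complex.I * κ * (‖x‖ : ℂ)) / (‖x‖ : ℂ)

theorem smoothOffZero_sphericalWave (κ : ℂ) : SmoothOffZero (sphericalWave κ) := by
  intro y hy
  have hn : ContDiffAt ℝ ∞ (fun y : E3 => ((‖y‖ : ℝ) : ℂ)) y :=
    Complex.ofRealCLM.contDiff.contDiffAt.comp y (contDiffAt_norm ℝ hy)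
  exact (contDiffAt_const.mul hn).cexp.mul (hn.inv (by simpa using hy))

theorem pd_sphericalWave (κ : ℂ) (i : Fin 3) {x : E3} (hx : x ≠ 0) :
    pd i (sphericalWave κ) x = (x i : ℂ) *
      (Complex.exp (Complex.I * κ * (‖x‖ : ℂ)) *
        (Complex.I * κ * (‖x‖ : ℂ) - 1) / (‖x‖ : ℂ) ^ 3) := by
  have hr : ((‖x‖ : ℝ) : ℂ) ≠ 0 := by simpa using hx
  have hid : HasDerivAt (fun r : ℝ => (r : ℂ)) 1 ‖x‖ := Complex.ofRealCLM.hasDerivAt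
  have hd := (hid.const_mul (Complex.I * κ)).cexp.div hid hr
  refine (pd_comp_norm i hx hd).trans ?_
  field_simp

theorem lap_sphericalWave (κ : ℂ) {x : E3} (hx : x ≠ 0) :
    lap (sphericalWave κ) x = -κ ^ 2 * sphericalWave κ x := by
  have hr : ((‖x‖ : ℝ) : ℂ) ≠ 0 := by simpa using hx
  have hid : HasDerivAt (fun r : ℝ => (r : ℂ)) 1 ‖x‖ := Complex.ofRealCLM.hasDerivAt
  have hd := ((hid.const_mul (Complex.I * κ)).cexp.mul
    ((hid.const_mul (Complex.I * κ)).sub_const 1)).div (hid.pow 3) (pow_ne_zero 3 hr)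
  have hsq : (x 0 : ℂ) ^ 2 + (x 1 : ℂ) ^ 2 + (x 2 : ℂ) ^ 2 = (‖x‖ : ℂ) ^ 2 := by
    have := EuclideanSpace.real_norm_sq_eq x
    rw [Fin.sum_univ_three] at this
    exact_mod_cast this.symm
  have hk (k : Fin 3) := (pd_congr k (fun y hy => pd_sphericalWave κ k hy) hx).trans
    (pd_coord_mul_comp_norm k hx hd)
  have hI := Complex.I_sq
  rw [lap, Fin.sum_univ_three, hk, hk, hk]
  simp only [Pi.mul_apply, Pi.div_apply, Pi.pow_apply, sphericalWave]
  generalize Complex.exp (Complex.I * κ * (‖x‖ : ℂ)) = e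
  have hcollect (a b : ℂ) : a + (x 0 : ℂ) ^ 2 * b + (a + (x 1 : ℂ) ^ 2 * b)
      + (a + (x 2 : ℂ) ^ 2 * b) = 3 * a + (‖x‖ : ℂ) ^ 2 * b := by
    rw [← hsq]
    ring
  rw [hcollect]
  field_simp
  push_cast
  ring_nf
  simp only [hI]
  ring

/-- The fundamental Stokes tensor satisfies the Stokes resolvent equation away from the
origin: `ΔΓ^λ_{ij}(x) + λΓ^λ_{ij}(x) = ∂_{x_j} F_i(x)`. -/
theorem stmt16 (lam : ℝ) (hlam : 0 < lam) (x : EuclideanSpace ℝ (Fin 3)) (hx : x ≠ 0)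
    (i j : Fin 3) :
    (∑ k : Fin 3, pd k (pd k (fun y => GammaLam lam i j y)) x)
        + (lam : ℂ) * GammaLam lam i j x
      = pd j (Fvec i) x := by
  have hW := smoothOffZero_sphericalWave (Real.sqrt lam : ℂ)
  have hN := smoothOffZero_sphericalWave 0
  have hsq : ((Real.sqrt lam : ℝ) : ℂ) ^ 2 = (lam : ℂ) := by
    exact_mod_cast Real.sq_sqrt hlam.le
  have hl : (lam : ℂ) ≠ 0 := by exact_mod_cast hlam.ne'
  have hpi : (Real.pi : ℂ) ≠ 0 := by exact_mod_cast Real.pi_ne_zero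
  set W := sphericalWave (Real.sqrt lam : ℂ) with hWdef
  set N := sphericalWave 0 with hNdef
  set δ : ℂ := if i = j then 1 else 0 with hδ
  have hlapW (y : E3) (hy : y ≠ 0) : lap W y = -(lam : ℂ) * W y := by
    rw [hWdef, lap_sphericalWave _ hy, hsq]
  have hlapN (y : E3) (hy : y ≠ 0) : lap N y = 0 := by
    simpa using lap_sphericalWave 0 hy
  have hdiff : (fun y : E3 => (Complex.exp (Complex.I * (Real.sqrt lam : ℂ) * (‖y‖ : ℂ)) - 1) /
      (‖y‖ : ℂ)) = fun y => W y - N y := by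
    ext y
    simp [hWdef, hNdef, sphericalWave, sub_div]
  have hG (y : E3) : GammaLam lam i j y = (-δ / (4 * Real.pi)) * W y
      - (1 / (4 * Real.pi * lam)) * pd i (pd j (fun y => W y - N y)) y := by
    rw [GammaLam, hdiff, hWdef, sphericalWave, ← hδ]
    congr 1
    ring
  have hD : SmoothOffZero (fun y => W y - N y) := hW.sub hN
  have hlapD (y : E3) (hy : y ≠ 0) : lap (fun y => W y - N y) y = -(lam : ℂ) * W y := by
    rw [lap_sub hW hN hy, hlapW y hy, hlapN y hy, sub_zero]
  have hlapDD : lap (pd i (pd j (fun y => W y - N y))) x = -(lam : ℂ) * pd i (pd j W) x := by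
    rw [lap_pd i (hD.pd j) hx, pd_congr i (fun y hy => (lap_pd j hD hy).trans
      ((pd_congr j hlapD hy).trans (pd_const_mul j _ hW hy))) hx,
      pd_const_mul i _ (hW.pd j) hx]
  have hlapG : lap (fun y => GammaLam lam i j y) x = (-δ / (4 * Real.pi)) * (-(lam : ℂ) * W x)
      - (1 / (4 * Real.pi * lam)) * (-(lam : ℂ) * pd i (pd j W) x) := by
    rw [lap_congr (fun y _ => hG y) hx,
      lap_sub (hW.const_mul _) (((hD.pd j).pd i).const_mul _) hx,
      lap_const_mul _ hW hx, lap_const_mul _ ((hD.pd j).pd i) hx, hlapW x hx, hlapDD]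
  have hDij : pd i (pd j (fun y => W y - N y)) x = pd i (pd j W) x - pd i (pd j N) x := by
    rw [pd_congr i (fun y hy => pd_sub j hW hN hy) hx, pd_sub i (hW.pd j) (hN.pd j) hx]
  have hF : pd j (Fvec i) x = (1 / (4 * Real.pi)) * pd i (pd j N) x := by
    rw [pd_comm i j hN hx, ← pd_const_mul j _ (hN.pd i) hx]
    refine pd_congr j (fun y hy => ?_) hx
    have hr : ((‖y‖ : ℝ) : ℂ) ≠ 0 := by simpa using hy
    rw [hNdef, pd_sphericalWave 0 i hy, Fvec]
    simp
    field_simp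
  change lap (fun y => GammaLam lam i j y) x + _ = _
  rw [hlapG, hG, hDij, hF]
  field_simp
  ring
end

section
/- For every compact set K⊂ℝ³ there exist constants C>0 and λ₀>0 such that for all λ∈(0,λ₀], all x∈K∖{0} and all i,j∈{1,2,3}, one has |Γ^λ_{ij}(x) − Γ⁰_{ij}(x) + δ_{ij}·i√λ/(6π)| ≤ C·λ; that is, Γ^λ_{ij}(x) = Γ⁰_{ij}(x) − δ_{ij}·i√λ/(6π) + O(λ) as λ→0⁺, uniformly on compact subsets of ℝ³. -/
open MeasureTheory

/-- The fundamental tensor `Γ⁰_{ij}` of the standard Stokes system: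
`Γ⁰_{ij}(x) = −(1/(8π))(δ_{ij}/|x| + x_i x_j/|x|³)`. -/
noncomputable def Gamma0 (i j : Fin 3) (x : EuclideanSpace ℝ (Fin 3)) : ℂ :=
  -(1 / (8 * (Real.pi : ℂ))) *
    ((if i = j then (1 : ℂ) else 0) / (‖x‖ : ℂ) +
      (x i : ℂ) * (x j : ℂ) / (‖x‖ : ℂ) ^ 3)

theorem norm_coord_le (x : EuclideanSpace ℝ (Fin 3)) (i : Fin 3) : ‖(x i : ℂ)‖ ≤ ‖x‖ := by
  rw [Complex.norm_real]
  exact PiLp.norm_apply_le x i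

theorem hasFDerivAt_norm_of_ne_zero {x : EuclideanSpace ℝ (Fin 3)} (hx : x ≠ 0) :
    HasFDerivAt (fun y : EuclideanSpace ℝ (Fin 3) => ‖y‖) (‖x‖⁻¹ • innerSL ℝ x) x := by
  have h1 : HasFDerivAt (fun y : EuclideanSpace ℝ (Fin 3) => ‖y‖ ^ 2) (2 • innerSL ℝ x) x :=
    (hasStrictFDerivAt_norm_sq x).hasFDerivAt
  have h2 := h1.sqrt (pow_ne_zero 2 (norm_ne_zero_iff.2 hx))
  simp only [Real.sqrt_sq (norm_nonneg _)] at h2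
  refine h2.congr_fderiv ?_
  ext v
  simp
  ring

theorem hasFDerivAt_radial {x : EuclideanSpace ℝ (Fin 3)} (hx : x ≠ 0) {g : ℝ → ℂ} {g' : ℂ}
    (hg : HasDerivAt g g' ‖x‖) :
    HasFDerivAt (fun y : EuclideanSpace ℝ (Fin 3) => g ‖y‖)
      ((ContinuousLinearMap.toSpanSingleton ℝ g').comp (‖x‖⁻¹ • innerSL ℝ x)) x :=
  hg.hasFDerivAt.comp x (hasFDerivAt_norm_of_ne_zero hx)

theorem pd_radial {x : EuclideanSpace ℝ (Fin 3)} (hx : x ≠ 0) {g : ℝ → ℂ} {g' : ℂ}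
    (hg : HasDerivAt g g' ‖x‖) (i : Fin 3) :
    pd i (fun y => g ‖y‖) x = (x i : ℂ) / (‖x‖ : ℂ) * g' := by
  rw [pd, (hasFDerivAt_radial hx hg).fderiv]
  simp [EuclideanSpace.inner_single_right, div_eq_inv_mul, mul_assoc]

theorem pd_coord_mul_radial {x : EuclideanSpace ℝ (Fin 3)} (hx : x ≠ 0) {g : ℝ → ℂ} {g' : ℂ}
    (hg : HasDerivAt g g' ‖x‖) (i j : Fin 3) :
    pd i (fun y => (y j : ℂ) * g ‖y‖) x =
      (if i = j then (1 : ℂ) else 0) * g ‖x‖ + (x i : ℂ) * (x j : ℂ) / (‖x‖ : ℂ) * g' := by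
  have hc : HasFDerivAt (fun y : EuclideanSpace ℝ (Fin 3) => (y j : ℂ))
      (Complex.ofRealCLM.comp (EuclideanSpace.proj j : EuclideanSpace ℝ (Fin 3) →L[ℝ] ℝ)) x :=
    (Complex.ofRealCLM.comp
      (EuclideanSpace.proj j : EuclideanSpace ℝ (Fin 3) →L[ℝ] ℝ)).hasFDerivAt
  rw [pd, HasFDerivAt.fderiv (f := fun y : EuclideanSpace ℝ (Fin 3) => (y j : ℂ) * g ‖y‖)
    (hc.mul (hasFDerivAt_radial hx hg))]
  simp [EuclideanSpace.inner_single_right, eq_comm (a := j)]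
  split_ifs <;> simp <;> ring

theorem hasDerivAt_exp_mul_ofReal (w : ℂ) (r : ℝ) :
    HasDerivAt (fun t : ℝ => Complex.exp (w * (t : ℂ))) (w * Complex.exp (w * (r : ℂ))) r := by
  have h := (((hasDerivAt_id (r : ℂ)).const_mul w).cexp).comp_ofReal
  simpa [mul_comm] using h

theorem hasDerivAt_exp_sub_one_div (w : ℂ) {r : ℝ} (hr : r ≠ 0) :
    HasDerivAt (fun t : ℝ => (Complex.exp (w * (t : ℂ)) - 1) / (t : ℂ))
      ((w * r * Complex.exp (w * r) - Complex.exp (w * r) + 1) / (r : ℂ) ^ 2) r := by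
  have hr' : (r : ℂ) ≠ 0 := Complex.ofReal_ne_zero.2 hr
  refine (((hasDerivAt_exp_mul_ofReal w r).sub_const 1).div
    (Complex.ofRealCLM.hasDerivAt (x := r)) hr').congr_deriv ?_
  simp
  ring

theorem hasDerivAt_radial_quotient (w : ℂ) {r : ℝ} (hr : r ≠ 0) :
    HasDerivAt (fun t : ℝ =>
        (w * t * Complex.exp (w * t) - Complex.exp (w * t) + 1) / (t : ℂ) ^ 3)
      (((w * r) ^ 2 * Complex.exp (w * r) - 3 * (w * r) * Complex.exp (w * r)
        + 3 * Complex.exp (w * r) - 3) / (r : ℂ) ^ 4) r := by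
  have hr' : (r : ℂ) ≠ 0 := Complex.ofReal_ne_zero.2 hr
  have hid : HasDerivAt (fun t : ℝ => (t : ℂ)) 1 r := Complex.ofRealCLM.hasDerivAt (x := r)
  have he := hasDerivAt_exp_mul_ofReal w r
  refine (((((hid.const_mul w).mul he).sub he).add_const 1).div (hid.pow 3)
    (pow_ne_zero 3 hr')).congr_deriv ?_
  simp
  field_simp
  ring

/-- The Hessian of `y ↦ (exp (w |y|) - 1) / |y|` away from the origin. -/
theorem pd_pd_exp_sub_one_div (w : ℂ) {x : EuclideanSpace ℝ (Fin 3)} (hx : x ≠ 0)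
    (i j : Fin 3) :
    pd i (pd j (fun y => (Complex.exp (w * (‖y‖ : ℂ)) - 1) / (‖y‖ : ℂ))) x =
      (if i = j then (1 : ℂ) else 0) *
        ((w * ‖x‖ * Complex.exp (w * ‖x‖) - Complex.exp (w * ‖x‖) + 1) / (‖x‖ : ℂ) ^ 3) +
      (x i : ℂ) * (x j : ℂ) / (‖x‖ : ℂ) *
        (((w * ‖x‖) ^ 2 * Complex.exp (w * ‖x‖) - 3 * (w * ‖x‖) * Complex.exp (w * ‖x‖)
          + 3 * Complex.exp (w * ‖x‖) - 3) / (‖x‖ : ℂ) ^ 4) := by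
  rw [← pd_coord_mul_radial hx (hasDerivAt_radial_quotient w (norm_ne_zero_iff.2 hx)) i j]
  refine congrArg (fun L : EuclideanSpace ℝ (Fin 3) →L[ℝ] ℂ => L (EuclideanSpace.single i 1))
    (Filter.EventuallyEq.fderiv_eq ?_)
  filter_upwards [isOpen_ne.mem_nhds hx] with y hy
  rw [pd_radial hy (hasDerivAt_exp_sub_one_div w (norm_ne_zero_iff.2 hy)) j]
  have : (‖y‖ : ℂ) ≠ 0 := Complex.ofReal_ne_zero.2 (norm_ne_zero_iff.2 hy)
  field_simp

/-- The cubic Taylor remainder of the exponential on the unit disc. -/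
theorem norm_exp_sub_cubic_le {z : ℂ} (hz : ‖z‖ ≤ 1) :
    ‖Complex.exp z - (1 + z + z ^ 2 / 2 + z ^ 3 / 6)‖ ≤ ‖z‖ ^ 4 * (1 / 16) := by
  have h := Complex.exp_bound hz (n := 4) (by norm_num)
  simp only [Finset.sum_range_succ, Finset.sum_range_zero, Nat.factorial] at h
  norm_num at h
  linarith [pow_nonneg (norm_nonneg z) 4]

theorem norm_diagonal_remainder_le {z : ℂ} (hz : ‖z‖ ≤ 1) :
    ‖-z ^ 2 * Complex.exp z + z * Complex.exp z - Complex.exp z + 1 + z ^ 2 / 2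
      + 2 * z ^ 3 / 3‖ ≤ ‖z‖ ^ 4 := by
  have hE := norm_exp_sub_cubic_le hz
  set E := Complex.exp z - (1 + z + z ^ 2 / 2 + z ^ 3 / 6) with hEdef
  have he : Complex.exp z = E + (1 + z + z ^ 2 / 2 + z ^ 3 / 6) := by rw [hEdef]; ring
  have hsplit : -z ^ 2 * Complex.exp z + z * Complex.exp z - Complex.exp z + 1 + z ^ 2 / 2
      + 2 * z ^ 3 / 3 = z ^ 4 * (-(1 / 3) - z / 6) + (-z ^ 2 + z - 1) * E := by
    rw [he]; ring
  have h1 : ‖-(1 / 3) - z / 6‖ ≤ 1 / 2 := by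
    refine (norm_sub_le _ _).trans ?_
    norm_num
    linarith
  have h2 : ‖-z ^ 2 + z - 1‖ ≤ 3 := by
    refine (norm_sub_le _ _).trans ?_
    have := norm_add_le (-z ^ 2) z
    have h3 : ‖z‖ ^ 2 ≤ 1 := pow_le_one₀ (norm_nonneg _) hz
    rw [norm_neg, norm_pow] at this
    rw [norm_one]
    linarith
  rw [hsplit]
  calc _ ≤ ‖z‖ ^ 4 * ‖-(1 / 3) - z / 6‖ + ‖-z ^ 2 + z - 1‖ * ‖E‖ := by
        refine (norm_add_le _ _).trans_eq ?_
        rw [norm_mul, norm_mul, norm_pow]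
    _ ≤ ‖z‖ ^ 4 * (1 / 2) + 3 * (‖z‖ ^ 4 * (1 / 16)) := by gcongr
    _ ≤ ‖z‖ ^ 4 := by linarith [pow_nonneg (norm_nonneg z) 4]

theorem norm_offdiagonal_remainder_le {z : ℂ} (hz : ‖z‖ ≤ 1) :
    ‖z ^ 2 * Complex.exp z - 3 * z * Complex.exp z + 3 * Complex.exp z - 3 + z ^ 2 / 2‖
      ≤ ‖z‖ ^ 4 := by
  have hE := norm_exp_sub_cubic_le hz
  set E := Complex.exp z - (1 + z + z ^ 2 / 2 + z ^ 3 / 6) with hEdef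
  have he : Complex.exp z = E + (1 + z + z ^ 2 / 2 + z ^ 3 / 6) := by rw [hEdef]; ring
  have hsplit : z ^ 2 * Complex.exp z - 3 * z * Complex.exp z + 3 * Complex.exp z - 3
      + z ^ 2 / 2 = z ^ 4 * (z / 6) + (z ^ 2 - 3 * z + 3) * E := by
    rw [he]; ring
  have h1 : ‖z / 6‖ ≤ 1 / 2 := by
    norm_num
    linarith
  have h2 : ‖z ^ 2 - 3 * z + 3‖ ≤ 7 := by
    refine (norm_add_le _ _).trans ?_
    have := norm_sub_le (z ^ 2) (3 * z)
    have h3 : ‖z‖ ^ 2 ≤ 1 := pow_le_one₀ (norm_nonneg _) hz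
    rw [norm_mul, norm_pow] at this
    norm_num at this ⊢
    linarith
  rw [hsplit]
  calc _ ≤ ‖z‖ ^ 4 * ‖z / 6‖ + ‖z ^ 2 - 3 * z + 3‖ * ‖E‖ := by
        refine (norm_add_le _ _).trans_eq ?_
        rw [norm_mul, norm_mul, norm_pow]
    _ ≤ ‖z‖ ^ 4 * (1 / 2) + 7 * (‖z‖ ^ 4 * (1 / 16)) := by gcongr
    _ ≤ ‖z‖ ^ 4 := by linarith [pow_nonneg (norm_nonneg z) 4]

theorem norm_GammaLam_sub_expansion_le {lam : ℝ} (hlam : 0 < lam)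
    {x : EuclideanSpace ℝ (Fin 3)} (hx : x ≠ 0) (hsmall : Real.sqrt lam * ‖x‖ ≤ 1)
    (i j : Fin 3) :
    ‖GammaLam lam i j x - Gamma0 i j x +
        (if i = j then (1 : ℂ) else 0) * Complex.I * (Real.sqrt lam : ℂ) /
          (6 * (Real.pi : ℂ))‖ ≤ ‖x‖ * lam := by
  have hr : 0 < ‖x‖ := norm_pos_iff.2 hx
  have hs : 0 < Real.sqrt lam := Real.sqrt_pos.2 hlam
  have hls : (lam : ℂ) = (Real.sqrt lam : ℂ) ^ 2 := by
    rw [← Complex.ofReal_pow, Real.sq_sqrt hlam.le]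
  have hls' : lam = Real.sqrt lam ^ 2 := (Real.sq_sqrt hlam.le).symm
  rw [GammaLam, Gamma0, pd_pd_exp_sub_one_div _ hx, hls]
  have hnorm : ‖Complex.I * (Real.sqrt lam : ℂ) * (‖x‖ : ℂ)‖ = Real.sqrt lam * ‖x‖ := by
    simp [abs_of_pos hs]
  have hA := norm_diagonal_remainder_le (hnorm.trans_le hsmall)
  have hB := norm_offdiagonal_remainder_le (hnorm.trans_le hsmall)
  rw [hnorm] at hA hB
  have hδ : ‖(if i = j then (1 : ℂ) else 0)‖ ≤ 1 := by split_ifs <;> simp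
  have hxx : ‖(x i : ℂ) * (x j : ℂ) / (‖x‖ : ℂ) ^ 2‖ ≤ 1 := by
    rw [norm_div, norm_mul, norm_pow, Complex.norm_real ‖x‖, norm_norm,
      div_le_one (by positivity), sq]
    exact mul_le_mul (norm_coord_le x i) (norm_coord_le x j) (norm_nonneg _) hr.le
  have hπ : (Real.pi : ℂ) ≠ 0 := Complex.ofReal_ne_zero.2 Real.pi_ne_zero
  have hrc : (‖x‖ : ℂ) ≠ 0 := Complex.ofReal_ne_zero.2 hr.ne'
  have hsc : (Real.sqrt lam : ℂ) ≠ 0 := Complex.ofReal_ne_zero.2 hs.ne'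
  have hc : ‖-(1 / (4 * (Real.pi : ℂ) * (Real.sqrt lam : ℂ) ^ 2 * (‖x‖ : ℂ) ^ 3))‖ =
      1 / (4 * Real.pi * Real.sqrt lam ^ 2 * ‖x‖ ^ 3) := by
    simp [abs_of_pos hs, abs_of_pos Real.pi_pos]
  generalize (if i = j then (1 : ℂ) else 0) = δ at hδ ⊢
  generalize hz : Complex.I * (Real.sqrt lam : ℂ) * (‖x‖ : ℂ) = z at hA hB ⊢
  generalize Complex.exp z = e at hA hB ⊢
  set A := -z ^ 2 * e + z * e - e + 1 + z ^ 2 / 2 + 2 * z ^ 3 / 3 with hAdef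
  set B := z ^ 2 * e - 3 * z * e + 3 * e - 3 + z ^ 2 / 2 with hBdef
  have hz2 : z ^ 2 = -((Real.sqrt lam : ℂ) ^ 2 * (‖x‖ : ℂ) ^ 2) := by
    rw [← hz, mul_pow, mul_pow, Complex.I_sq]; ring
  have hz3 : z ^ 3 = -((Real.sqrt lam : ℂ) ^ 2 * (‖x‖ : ℂ) ^ 2) *
      (Complex.I * (Real.sqrt lam : ℂ) * (‖x‖ : ℂ)) := by
    rw [pow_succ, hz2, hz]
  refine (congrArg norm (?_ : _ =
    -(1 / (4 * (Real.pi : ℂ) * (Real.sqrt lam : ℂ) ^ 2 * (‖x‖ : ℂ) ^ 3)) *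
      (δ * A + ((x i : ℂ) * (x j : ℂ) / (‖x‖ : ℂ) ^ 2) * B))).trans_le ?_
  · rw [hAdef, hBdef, mul_div_assoc 2 (z ^ 3) 3, hz3, hz2]
    field_simp
    ring
  rw [norm_mul, hc]
  have hsum : ‖δ * A + ((x i : ℂ) * (x j : ℂ) / (‖x‖ : ℂ) ^ 2) * B‖ ≤
      2 * (Real.sqrt lam * ‖x‖) ^ 4 := by
    refine (norm_add_le _ _).trans ?_
    rw [norm_mul, norm_mul, two_mul]
    exact add_le_add ((mul_le_of_le_one_left (norm_nonneg _) hδ).trans hA)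
      ((mul_le_of_le_one_left (norm_nonneg _) hxx).trans hB)
  calc _ ≤ 1 / (4 * Real.pi * Real.sqrt lam ^ 2 * ‖x‖ ^ 3) *
        (2 * (Real.sqrt lam * ‖x‖) ^ 4) := by gcongr
    _ = 1 / (2 * Real.pi) * (‖x‖ * lam) := by
        rw [hls', Real.sqrt_sq hs.le]
        field_simp
        ring
    _ ≤ ‖x‖ * lam := by
        refine mul_le_of_le_one_left (by positivity) ?_
        rw [div_le_one (by positivity)]
        linarith [Real.pi_gt_three]

/-- `Γ^λ_{ij}(x) = Γ⁰_{ij}(x) − δ_{ij} i√λ/(6π) + O(λ)` as `λ → 0⁺`, uniformly on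
compact subsets of `ℝ³`. -/
theorem stmt17 (K : Set (EuclideanSpace ℝ (Fin 3))) (hK : IsCompact K) :
    ∃ C : ℝ, 0 < C ∧ ∃ lam0 : ℝ, 0 < lam0 ∧
      ∀ lam : ℝ, 0 < lam → lam ≤ lam0 →
        ∀ x ∈ K, x ≠ 0 → ∀ i j : Fin 3,
          ‖GammaLam lam i j x - Gamma0 i j x +
              (if i = j then (1 : ℂ) else 0) * Complex.I * (Real.sqrt lam : ℂ) /
                (6 * (Real.pi : ℂ))‖ ≤ C * lam := by
  obtain ⟨R, hR⟩ := hK.isBounded.exists_norm_le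
  have hM : 0 < max R 1 := lt_max_of_lt_right one_pos
  refine ⟨max R 1, hM, (1 / max R 1) ^ 2, by positivity, fun lam hlam hle x hxK hx i j => ?_⟩
  have hxM : ‖x‖ ≤ max R 1 := (hR x hxK).trans (le_max_left _ _)
  have hsq : Real.sqrt lam ≤ 1 / max R 1 := Real.sqrt_le_iff.2 ⟨by positivity, hle⟩
  refine (norm_GammaLam_sub_expansion_le hlam hx ?_ i j).trans (by gcongr)
  calc Real.sqrt lam * ‖x‖ ≤ 1 / max R 1 * max R 1 := by gcongr
    _ = 1 := by field_simp
end
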